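/- arXiv:2105.02718 — 11 statements merged into one kernel-verified Lean document; each statement's English description precedes it below -/
import Mathlib

section
/- Let N, n be positive integers, let L : ℝ^N → ℝ^n be a surjective linear map with adjoint L*, and let G, F : ℝ^N × ℝ^N → ℝ^N and G̃, F̃ : ℝ^n × ℝ^n → ℝ^n satisfy, for all x ∈ ℝ^N and u ∈ ℝ^n, G(x, L*u) = L*(G̃(Lx, u)) and L(F(x, L*u)) = F̃(Lx, u). If the map ℝ^{2N} ∋ (x, U) ↦ (G(x,U), F(x,U)) ∈ ℝ^{2N} is monotone, then the map ℝ^{2n} ∋ (y, u) ↦ (G̃(y,u), F̃(y,u)) ∈ ℝ^{2n} is monotone. -/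
open RealInnerProductSpace

/-- If `(x,U) ↦ (G(x,U), F(x,U))` is monotone on `ℝ^{2N}` and `G, F` reduce through a
surjective linear map `L : ℝ^N → ℝ^n` via `G(x, L*u) = L*(G'(Lx, u))` and
`L(F(x, L*u)) = F'(Lx, u)`, then `(y,u) ↦ (G'(y,u), F'(y,u))` is monotone on `ℝ^{2n}`. -/
theorem reduced_nonlinearity_monotone (N n : ℕ) (hN : 0 < N) (hn : 0 < n)
    (L : EuclideanSpace ℝ (Fin N) →L[ℝ] EuclideanSpace ℝ (Fin n))
    (hL : Function.Surjective L)
    (G F : EuclideanSpace ℝ (Fin N) → EuclideanSpace ℝ (Fin N) → EuclideanSpace ℝ (Fin N))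
    (G' F' : EuclideanSpace ℝ (Fin n) → EuclideanSpace ℝ (Fin n) → EuclideanSpace ℝ (Fin n))
    (hG : ∀ (x : EuclideanSpace ℝ (Fin N)) (u : EuclideanSpace ℝ (Fin n)),
      G x ((ContinuousLinearMap.adjoint L) u) = (ContinuousLinearMap.adjoint L) (G' (L x) u))
    (hF : ∀ (x : EuclideanSpace ℝ (Fin N)) (u : EuclideanSpace ℝ (Fin n)),
      L (F x ((ContinuousLinearMap.adjoint L) u)) = F' (L x) u)
    (hmono : ∀ x y U W : EuclideanSpace ℝ (Fin N),
      0 ≤ ⟪G x U - G y W, x - y⟫ + ⟪F x U - F y W, U - W⟫) :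
    ∀ y₁ y₂ u₁ u₂ : EuclideanSpace ℝ (Fin n),
      0 ≤ ⟪G' y₁ u₁ - G' y₂ u₂, y₁ - y₂⟫ + ⟪F' y₁ u₁ - F' y₂ u₂, u₁ - u₂⟫ := by
  intro y₁ y₂ u₁ u₂
  obtain ⟨x₁, rfl⟩ := hL y₁
  obtain ⟨x₂, rfl⟩ := hL y₂
  have h := hmono x₁ x₂ ((ContinuousLinearMap.adjoint L) u₁) ((ContinuousLinearMap.adjoint L) u₂)
  rw [hG, hG, ← map_sub, ← map_sub, ContinuousLinearMap.adjoint_inner_left,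
    ContinuousLinearMap.adjoint_inner_right, map_sub, map_sub, hF, hF] at h
  exact h
end

section
/- Let N, n be positive integers, let L : ℝ^N → ℝ^n be a surjective linear map with adjoint L*, and let F : ℝ^N × ℝ^N → ℝ^N, G : ℝ^N × ℝ^N → ℝ^N, U₀ : ℝ^N → ℝ^N, F̃, G̃ : ℝ^n × ℝ^n → ℝ^n, Ũ₀ : ℝ^n → ℝ^n satisfy, for all x ∈ ℝ^N and u ∈ ℝ^n: G(x, L*u) = L*(G̃(Lx, u)), L(F(x, L*u)) = F̃(Lx, u), and U₀(x) = L*(Ũ₀(Lx)). Suppose Ũ : [0,T] × ℝ^n → ℝ^n is continuously differentiable and solves ∂_t Ũ(t,y) + D_y Ũ(t,y)[F̃(y, Ũ(t,y))] = G̃(y, Ũ(t,y)) for all (t,y) ∈ (0,T] × ℝ^n, with Ũ(0,·) = Ũ₀. Then U(t,x) := L*(Ũ(t, Lx)) is continuously differentiable and solves ∂_t U(t,x) + D_x U(t,x)[F(x, U(t,x))] = G(x, U(t,x)) for all (t,x) ∈ (0,T] × ℝ^N, with U(0,·) = U₀. -/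
open RealInnerProductSpace

/-- If `U'` solves the reduced master equation
`∂_t U' + D_y U'[F'(y,U')] = G'(y,U')` on `(0,T] × ℝ^n` with `U'(0,·) = U₀'`, and the data
`F, G, U₀` reduce through the surjective linear map `L`, then
`U(t,x) := L*(U'(t, Lx))` is a `C¹` solution of `∂_t U + D_x U[F(x,U)] = G(x,U)` with
`U(0,·) = U₀`. -/
theorem reduced_finite_state_master_equation (N n : ℕ) (hN : 0 < N) (hn : 0 < n)
    (T : ℝ) (hT : 0 < T)
    (L : EuclideanSpace ℝ (Fin N) →L[ℝ] EuclideanSpace ℝ (Fin n))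
    (hL : Function.Surjective L)
    (F G : EuclideanSpace ℝ (Fin N) → EuclideanSpace ℝ (Fin N) → EuclideanSpace ℝ (Fin N))
    (U₀ : EuclideanSpace ℝ (Fin N) → EuclideanSpace ℝ (Fin N))
    (F' G' : EuclideanSpace ℝ (Fin n) → EuclideanSpace ℝ (Fin n) → EuclideanSpace ℝ (Fin n))
    (U₀' : EuclideanSpace ℝ (Fin n) → EuclideanSpace ℝ (Fin n))
    (hG : ∀ (x : EuclideanSpace ℝ (Fin N)) (u : EuclideanSpace ℝ (Fin n)),
      G x ((ContinuousLinearMap.adjoint L) u) = (ContinuousLinearMap.adjoint L) (G' (L x) u))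
    (hF : ∀ (x : EuclideanSpace ℝ (Fin N)) (u : EuclideanSpace ℝ (Fin n)),
      L (F x ((ContinuousLinearMap.adjoint L) u)) = F' (L x) u)
    (hU₀ : ∀ x : EuclideanSpace ℝ (Fin N),
      U₀ x = (ContinuousLinearMap.adjoint L) (U₀' (L x)))
    (U' : ℝ × EuclideanSpace ℝ (Fin n) → EuclideanSpace ℝ (Fin n))
    (hU'reg : ContDiff ℝ 1 U')
    (hU'eq : ∀ t ∈ Set.Ioc (0 : ℝ) T, ∀ y : EuclideanSpace ℝ (Fin n),
      fderiv ℝ U' (t, y) (1, F' y (U' (t, y))) = G' y (U' (t, y)))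
    (hU'0 : ∀ y : EuclideanSpace ℝ (Fin n), U' (0, y) = U₀' y)
    (U : ℝ × EuclideanSpace ℝ (Fin N) → EuclideanSpace ℝ (Fin N))
    (hU : ∀ (t : ℝ) (x : EuclideanSpace ℝ (Fin N)),
      U (t, x) = (ContinuousLinearMap.adjoint L) (U' (t, L x))) :
    ContDiff ℝ 1 U ∧
    (∀ t ∈ Set.Ioc (0 : ℝ) T, ∀ x : EuclideanSpace ℝ (Fin N),
      fderiv ℝ U (t, x) (1, F x (U (t, x))) = G x (U (t, x))) ∧
    (∀ x : EuclideanSpace ℝ (Fin N), U (0, x) = U₀ x) := by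
  let P : ℝ × EuclideanSpace ℝ (Fin N) →L[ℝ] ℝ × EuclideanSpace ℝ (Fin n) :=
    (ContinuousLinearMap.id ℝ ℝ).prodMap L
  have hUe : U = fun p => (ContinuousLinearMap.adjoint L) (U' (P p)) := by
    funext p
    exact hU p.1 p.2
  refine ⟨?_, ?_, ?_⟩
  · rw [hUe]
    exact (ContinuousLinearMap.adjoint L).contDiff.comp (hU'reg.comp P.contDiff)
  · intro t ht x
    have hd : HasFDerivAt U' (fderiv ℝ U' (P (t, x))) (P (t, x)) :=
      (hU'reg.differentiable one_ne_zero (P (t, x))).hasFDerivAt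
    have h : HasFDerivAt U ((ContinuousLinearMap.adjoint L).comp
        ((fderiv ℝ U' (P (t, x))).comp P)) (t, x) := by
      rw [hUe]
      exact (ContinuousLinearMap.adjoint L).hasFDerivAt.comp (t, x)
        (hd.comp (t, x) P.hasFDerivAt)
    rw [h.fderiv, hU, hG, ← hU'eq t ht (L x), ← hF x]
    rfl
  · intro x
    rw [hU, hU'0, hU₀]
end

section
/- Let h : (0,∞) × ℝ → ℝ be such that h and ∂_u h are continuously differentiable on (0,∞) × ℝ. Then the map (0,∞) × ℝ ∋ (z,u) ↦ (−h(z,u), z ∂_u h(z,u)) ∈ ℝ² is monotone if and only if for all z > 0 and u ∈ ℝ: ∂_z h(z,u) ≤ 0, ∂²_{uu} h(z,u) ≥ 0, and z (∂²_{uz} h(z,u))² ≤ −4 ∂_z h(z,u) ∂²_{uu} h(z,u). -/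
theorem line_deriv_aux (f : ℝ → ℝ → ℝ)
    (hf : ContDiffOn ℝ 1 (fun p : ℝ × ℝ => f p.1 p.2) (Set.Ioi (0 : ℝ) ×ˢ Set.univ))
    (z u s t x : ℝ) (hx : 0 < z + x * s) :
    HasDerivAt (fun y => f (z + y * s) (u + y * t))
      (deriv (fun w => f w (u + x * t)) (z + x * s) * s
        + deriv (fun v => f (z + x * s) v) (u + x * t) * t) x := by
  have hopen : IsOpen (Set.Ioi (0 : ℝ) ×ˢ (Set.univ : Set ℝ)) := isOpen_Ioi.prod isOpen_univ
  have hd : DifferentiableAt ℝ (fun p : ℝ × ℝ => f p.1 p.2) (z + x * s, u + x * t) :=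
    (hf.differentiableOn (by norm_num)).differentiableAt
      (hopen.mem_nhds ⟨hx, Set.mem_univ _⟩)
  obtain ⟨L, hL⟩ := hd
  have h1 : HasDerivAt (fun w => f w (u + x * t)) (L (1, 0)) (z + x * s) :=
    HasFDerivAt.comp_hasDerivAt (z + x * s) (f := fun w : ℝ => (w, u + x * t)) hL
      ((hasDerivAt_id _).prodMk (hasDerivAt_const _ _))
  have h2 : HasDerivAt (fun v => f (z + x * s) v) (L (0, 1)) (u + x * t) :=
    HasFDerivAt.comp_hasDerivAt (u + x * t) (f := fun v : ℝ => (z + x * s, v)) hL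
      ((hasDerivAt_const _ _).prodMk (hasDerivAt_id _))
  have h3 : HasDerivAt (fun y => f (z + y * s) (u + y * t)) (L (s, t)) x := by
    refine HasFDerivAt.comp_hasDerivAt x (f := fun y : ℝ => (z + y * s, u + y * t)) hL
      (HasDerivAt.prodMk ?_ ?_)
    · simpa using ((hasDerivAt_id x).mul_const s).const_add z
    · simpa using ((hasDerivAt_id x).mul_const t).const_add u
  rw [h1.deriv, h2.deriv]
  have e : ((s, t) : ℝ × ℝ) = s • ((1, 0) : ℝ × ℝ) + t • ((0, 1) : ℝ × ℝ) := by
    ext <;> simp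
  rw [e, map_add, map_smul, map_smul, smul_eq_mul, smul_eq_mul] at h3
  convert h3 using 1
  ring

theorem field_deriv_aux (h : ℝ → ℝ → ℝ)
    (hreg : ContDiffOn ℝ 1 (fun p : ℝ × ℝ => h p.1 p.2) (Set.Ioi (0 : ℝ) ×ˢ Set.univ))
    (hureg : ContDiffOn ℝ 1 (fun p : ℝ × ℝ => deriv (h p.1) p.2)
      (Set.Ioi (0 : ℝ) ×ˢ Set.univ))
    (z u s t x : ℝ) (hx : 0 < z + x * s) :
    HasDerivAt (fun y => -h (z + y * s) (u + y * t) * s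
        + (z + y * s) * deriv (h (z + y * s)) (u + y * t) * t)
      (-deriv (fun w => h w (u + x * t)) (z + x * s) * s ^ 2
        + (z + x * s) * deriv (fun w => deriv (h w) (u + x * t)) (z + x * s) * s * t
        + (z + x * s) * deriv (fun v => deriv (h (z + x * s)) v) (u + x * t) * t ^ 2) x := by
  have h1 := line_deriv_aux h hreg z u s t x hx
  have h2 := line_deriv_aux (fun a b => deriv (h a) b) hureg z u s t x hx
  have h3 : HasDerivAt (fun y : ℝ => z + y * s) s x := by
    simpa using ((hasDerivAt_id x).mul_const s).const_add z
  have h4 := (h1.neg.mul_const s).add ((h3.mul h2).mul_const t)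
  refine HasDerivAt.congr_deriv h4 ?_
  have : deriv (fun v => h (z + x * s) v) (u + x * t) = deriv (h (z + x * s)) (u + x * t) := rfl
  ring

/-- For `h = h(z,u)` with `h` and `∂_u h` continuously differentiable on `(0,∞) × ℝ`, the
map `(z,u) ↦ (−h(z,u), z ∂_u h(z,u))` is monotone on `(0,∞) × ℝ` if and only if
`∂_z h ≤ 0`, `∂²_{uu} h ≥ 0` and `z (∂²_{uz} h)² ≤ −4 ∂_z h ∂²_{uu} h` there. -/
theorem monotonicity_characterization_1d (h : ℝ → ℝ → ℝ)
    (hreg : ContDiffOn ℝ 1 (fun p : ℝ × ℝ => h p.1 p.2) (Set.Ioi (0 : ℝ) ×ˢ Set.univ))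
    (hureg : ContDiffOn ℝ 1 (fun p : ℝ × ℝ => deriv (h p.1) p.2)
      (Set.Ioi (0 : ℝ) ×ˢ Set.univ)) :
    (∀ z₁ ∈ Set.Ioi (0 : ℝ), ∀ z₂ ∈ Set.Ioi (0 : ℝ), ∀ u₁ u₂ : ℝ,
      0 ≤ (-h z₁ u₁ - -h z₂ u₂) * (z₁ - z₂)
        + (z₁ * deriv (h z₁) u₁ - z₂ * deriv (h z₂) u₂) * (u₁ - u₂)) ↔
    (∀ z ∈ Set.Ioi (0 : ℝ), ∀ u : ℝ,
      deriv (fun w => h w u) z ≤ 0 ∧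
      0 ≤ deriv (fun v => deriv (h z) v) u ∧
      z * (deriv (fun w => deriv (h w) u) z) ^ 2
        ≤ -4 * deriv (fun w => h w u) z * deriv (fun v => deriv (h z) v) u) := by
  constructor
  · intro H z hz u
    have hz' : 0 < z := hz
    have Q : ∀ s t : ℝ, 0 ≤ -deriv (fun w => h w u) z * s ^ 2
        + z * deriv (fun w => deriv (h w) u) z * s * t
        + z * deriv (fun v => deriv (h z) v) u * t ^ 2 := by
      intro s t
      have hd := field_deriv_aux h hreg hureg z u s t 0 (by simpa using hz')
      have hs := hasDerivAt_iff_tendsto_slope.1 hd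
      simp only [zero_mul, add_zero] at hs
      refine ge_of_tendsto hs ?_
      have hc : ∀ᶠ y in nhds (0 : ℝ), 0 < z + y * s := by
        have : Continuous (fun y : ℝ => z + y * s) := by fun_prop
        exact this.continuousAt.eventually_mem (isOpen_Ioi.mem_nhds (by simpa using hz'))
      filter_upwards [hc.filter_mono nhdsWithin_le_nhds, self_mem_nhdsWithin] with y hy hy0
      have hy0' : y ≠ 0 := hy0
      have := H (z + y * s) hy z hz (u + y * t) u
      rw [slope_def_field]
      simp only [zero_mul, add_zero, sub_zero]
      have hy2 : 0 < y ^ 2 := by positivity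
      refine le_of_le_of_eq (div_nonneg this hy2.le) ?_
      field_simp
      ring
    have qa := Q 1 0
    have qd := Q 0 1
    have hq := discrim_le_zero (a := -deriv (fun w => h w u) z)
      (b := z * deriv (fun w => deriv (h w) u) z)
      (c := z * deriv (fun v => deriv (h z) v) u) (fun x => by
        have := Q x 1
        nlinarith [this])
    unfold discrim at hq
    refine ⟨by linarith, ?_, ?_⟩
    · have : 0 ≤ z * deriv (fun v => deriv (h z) v) u := by linarith
      exact nonneg_of_mul_nonneg_right this hz'
    · refine le_of_mul_le_mul_left ?_ hz'
      linarith
  · intro H z₁ hz₁ z₂ hz₂ u₁ u₂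
    have hz₁' : 0 < z₁ := hz₁
    have hz₂' : 0 < z₂ := hz₂
    have pos : ∀ x ∈ Set.Icc (0 : ℝ) 1, 0 < z₂ + x * (z₁ - z₂) := by
      rintro x ⟨h0, h1⟩
      rcases h0.eq_or_lt with rfl | h0
      · simpa using hz₂'
      · nlinarith [mul_pos h0 hz₁', mul_nonneg (sub_nonneg.2 h1) hz₂'.le]
    have D := fun x hx => field_deriv_aux h hreg hureg z₂ u₂ (z₁ - z₂) (u₁ - u₂) x (pos x hx)
    have mono := monotoneOn_of_deriv_nonneg (convex_Icc (0 : ℝ) 1)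
      (fun x hx => (D x hx).continuousAt.continuousWithinAt)
      (fun x hx => (D x (interior_subset hx)).differentiableAt.differentiableWithinAt)
      (fun x hx => by
        have hx' := interior_subset hx
        rw [(D x hx').deriv]
        have hp := pos x hx'
        obtain ⟨ha, hd, hc⟩ := H _ hp (u₂ + x * (u₁ - u₂))
        generalize deriv (fun w => h w (u₂ + x * (u₁ - u₂))) (z₂ + x * (z₁ - z₂)) = a at *
        generalize deriv (fun w => deriv (h w) (u₂ + x * (u₁ - u₂))) (z₂ + x * (z₁ - z₂)) = c at *
        generalize deriv (fun v => deriv (h (z₂ + x * (z₁ - z₂))) v) (u₂ + x * (u₁ - u₂)) = d at *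
        generalize z₂ + x * (z₁ - z₂) = z at *
        generalize z₁ - z₂ = s at *
        generalize u₁ - u₂ = t at *
        rcases ha.eq_or_lt with rfl | ha
        · have : c = 0 := by
            have : z * c ^ 2 ≤ 0 := by simpa using hc
            have : c ^ 2 ≤ 0 := by
              by_contra hh
              push Not at hh
              nlinarith [mul_pos hp hh]
            nlinarith [pow_eq_zero_iff (two_ne_zero) |>.1 (le_antisymm this (sq_nonneg c))]
          subst this
          have := mul_nonneg (mul_nonneg hp.le hd) (sq_nonneg t)
          linarith
        · have e : 0 ≤ (-4 * a) * (-a * s ^ 2 + z * c * s * t + z * d * t ^ 2) := by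
            have k := mul_nonneg (mul_nonneg hp.le (sub_nonneg.2 hc)) (sq_nonneg t)
            nlinarith [sq_nonneg (2 * a * s - z * c * t)]
          exact nonneg_of_mul_nonneg_right e (by linarith))
    have := mono (Set.left_mem_Icc.2 zero_le_one) (Set.right_mem_Icc.2 zero_le_one) zero_le_one
    simp only [zero_mul, add_zero, one_mul, add_sub_cancel] at this
    linarith
end

section
/- Let L : ℝ^N → ℝ^n be a surjective linear map with adjoint L*, let F, G : ℝ^N × ℝ^N → ℝ^N and F̃, G̃ : ℝ^n × ℝ^n → ℝ^n be locally Lipschitz and satisfy G(x, L*u) = L*(G̃(Lx, u)) and L(F(x, L*u)) = F̃(Lx, u) for all x ∈ ℝ^N, u ∈ ℝ^n, and let U₀(x) = L*(Ũ₀(Lx)) for a map Ũ₀ : ℝ^n → ℝ^n. Fix x₀ ∈ ℝ^N and T > 0. Suppose (X, V) : [0,T] → ℝ^N × ℝ^N solves Ẋ = F(X,V), V̇ = G(X,V) with X(0) = x₀, V(0) = U₀(x₀), and (X̃, Ṽ) : [0,T] → ℝ^n × ℝ^n solves X̃' = F̃(X̃, Ṽ), Ṽ' = G̃(X̃, Ṽ)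 with X̃(0) = L x₀, Ṽ(0) = Ũ₀(L x₀). Then for all t ∈ [0,T]: L(X(t)) = X̃(t) and V(t) = L*(Ṽ(t)). -/
/-- A locally Lipschitz map is Lipschitz along two continuous curves on a compact interval. -/
lemma exists_lip_along {E H : Type*} [NormedAddCommGroup E] [NormedAddCommGroup H]
    {f : E → H} (hf : LocallyLipschitz f) {T : ℝ} {a b : ℝ → E}
    (ha : ContinuousOn a (Set.Icc 0 T)) (hb : ContinuousOn b (Set.Icc 0 T)) :
    ∃ K : ℝ, 0 ≤ K ∧ ∀ t ∈ Set.Icc 0 T, ‖f (a t) - f (b t)‖ ≤ K * ‖a t - b t‖ := by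
  have hc : IsCompact (a '' Set.Icc 0 T ∪ b '' Set.Icc 0 T) :=
    (isCompact_Icc.image_of_continuousOn ha).union (isCompact_Icc.image_of_continuousOn hb)
  obtain ⟨K, hK⟩ := (hf.locallyLipschitzOn).exists_lipschitzOnWith_of_compact hc
  refine ⟨K, K.2, fun t ht => ?_⟩
  exact hK.norm_sub_le (Or.inl ⟨t, ht, rfl⟩) (Or.inr ⟨t, ht, rfl⟩)

/-- The characteristics of the full finite-state system and of the reduced system are
related by `L X(t) = X'(t)` and `V(t) = L* V'(t)`. -/
theorem reduced_characteristics (N n : ℕ) (T : ℝ) (hT : 0 < T)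
    (L : EuclideanSpace ℝ (Fin N) →L[ℝ] EuclideanSpace ℝ (Fin n))
    (hL : Function.Surjective L)
    (F G : EuclideanSpace ℝ (Fin N) → EuclideanSpace ℝ (Fin N) → EuclideanSpace ℝ (Fin N))
    (F' G' : EuclideanSpace ℝ (Fin n) → EuclideanSpace ℝ (Fin n) → EuclideanSpace ℝ (Fin n))
    (U₀' : EuclideanSpace ℝ (Fin n) → EuclideanSpace ℝ (Fin n))
    (hFlip : LocallyLipschitz fun p : EuclideanSpace ℝ (Fin N) × EuclideanSpace ℝ (Fin N) =>
      F p.1 p.2)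
    (hGlip : LocallyLipschitz fun p : EuclideanSpace ℝ (Fin N) × EuclideanSpace ℝ (Fin N) =>
      G p.1 p.2)
    (hF'lip : LocallyLipschitz fun p : EuclideanSpace ℝ (Fin n) × EuclideanSpace ℝ (Fin n) =>
      F' p.1 p.2)
    (hG'lip : LocallyLipschitz fun p : EuclideanSpace ℝ (Fin n) × EuclideanSpace ℝ (Fin n) =>
      G' p.1 p.2)
    (hG : ∀ (x : EuclideanSpace ℝ (Fin N)) (u : EuclideanSpace ℝ (Fin n)),
      G x ((ContinuousLinearMap.adjoint L) u) = (ContinuousLinearMap.adjoint L) (G' (L x) u))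
    (hF : ∀ (x : EuclideanSpace ℝ (Fin N)) (u : EuclideanSpace ℝ (Fin n)),
      L (F x ((ContinuousLinearMap.adjoint L) u)) = F' (L x) u)
    (x₀ : EuclideanSpace ℝ (Fin N))
    (X V : ℝ → EuclideanSpace ℝ (Fin N))
    (X' V' : ℝ → EuclideanSpace ℝ (Fin n))
    (hX : ∀ t ∈ Set.Icc (0 : ℝ) T, HasDerivAt X (F (X t) (V t)) t)
    (hV : ∀ t ∈ Set.Icc (0 : ℝ) T, HasDerivAt V (G (X t) (V t)) t)
    (hX0 : X 0 = x₀)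
    (hV0 : V 0 = (ContinuousLinearMap.adjoint L) (U₀' (L x₀)))
    (hX' : ∀ t ∈ Set.Icc (0 : ℝ) T, HasDerivAt X' (F' (X' t) (V' t)) t)
    (hV' : ∀ t ∈ Set.Icc (0 : ℝ) T, HasDerivAt V' (G' (X' t) (V' t)) t)
    (hX'0 : X' 0 = L x₀)
    (hV'0 : V' 0 = U₀' (L x₀)) :
    ∀ t ∈ Set.Icc (0 : ℝ) T,
      L (X t) = X' t ∧ V t = (ContinuousLinearMap.adjoint L) (V' t) := by
  have cX : ContinuousOn X (Set.Icc 0 T) := fun t ht => (hX t ht).continuousAt.continuousWithinAt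
  have cV : ContinuousOn V (Set.Icc 0 T) := fun t ht => (hV t ht).continuousAt.continuousWithinAt
  have cX' : ContinuousOn X' (Set.Icc 0 T) :=
    fun t ht => (hX' t ht).continuousAt.continuousWithinAt
  have cV' : ContinuousOn V' (Set.Icc 0 T) :=
    fun t ht => (hV' t ht).continuousAt.continuousWithinAt
  set A := ContinuousLinearMap.adjoint L with hA
  have cLX : ContinuousOn (fun t => L (X t)) (Set.Icc 0 T) := L.continuous.comp_continuousOn cX
  have cAV : ContinuousOn (fun t => A (V' t)) (Set.Icc 0 T) := A.continuous.comp_continuousOn cV'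
  obtain ⟨K1, h1, k1⟩ := exists_lip_along hFlip (cX.prodMk cV) (cX.prodMk cAV)
  obtain ⟨K2, h2, k2⟩ := exists_lip_along hGlip (cX.prodMk cV) (cX.prodMk cAV)
  obtain ⟨K3, h3, k3⟩ := exists_lip_along hF'lip (cLX.prodMk cV') (cX'.prodMk cV')
  obtain ⟨K4, h4, k4⟩ := exists_lip_along hG'lip (cLX.prodMk cV') (cX'.prodMk cV')
  have key := norm_le_gronwallBound_of_norm_deriv_right_le
    (f := fun t => (L (X t) - X' t, V t - A (V' t)))
    (f' := fun t => (L (F (X t) (V t)) - F' (X' t) (V' t), G (X t) (V t) - A (G' (X' t) (V' t))))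
    (δ := 0) (K := (‖L‖ * K1 + K3) + (K2 + ‖A‖ * K4)) (ε := 0) (a := 0) (b := T)
    ((cLX.sub cX').prodMk (cV.sub cAV)) ?_ ?_ ?_
  · intro t ht
    have h := key t ht
    rw [gronwallBound_ε0_δ0] at h
    have h0 := norm_le_zero_iff.1 h
    rw [Prod.mk_eq_zero] at h0
    exact ⟨sub_eq_zero.1 h0.1, sub_eq_zero.1 h0.2⟩
  · intro t ht
    have ht := Set.Ico_subset_Icc_self ht
    exact (((L.hasFDerivAt.comp_hasDerivAt t (hX t ht)).sub (hX' t ht)).prodMk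
      ((hV t ht).sub (A.hasFDerivAt.comp_hasDerivAt t (hV' t ht)))).hasDerivWithinAt
  · simp [hX0, hV0, hX'0, hV'0]
  · intro t ht
    have ht := Set.Ico_subset_Icc_self ht
    have e1 := k1 t ht
    have e2 := k2 t ht
    have e3 := k3 t ht
    have e4 := k4 t ht
    simp only [Prod.mk_sub_mk, sub_self, Prod.norm_mk, norm_zero, norm_nonneg, sup_of_le_right,
      sup_of_le_left] at e1 e2 e3 e4
    have i1 : L (F (X t) (V t)) - F' (X' t) (V' t)
        = L (F (X t) (V t) - F (X t) (A (V' t))) + (F' (L (X t)) (V' t) - F' (X' t) (V' t)) := by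
      rw [map_sub, hF]; abel
    have i2 : G (X t) (V t) - A (G' (X' t) (V' t))
        = (G (X t) (V t) - G (X t) (A (V' t))) + A (G' (L (X t)) (V' t) - G' (X' t) (V' t)) := by
      rw [map_sub, hG]; abel
    set M := ‖(L (X t) - X' t, V t - A (V' t))‖ with hM
    have m1 : ‖L (X t) - X' t‖ ≤ M := le_max_left _ _
    have m2 : ‖V t - A (V' t)‖ ≤ M := le_max_right _ _
    have m0 : 0 ≤ M := norm_nonneg _
    have j1 : ‖L (F (X t) (V t)) - F' (X' t) (V' t)‖ ≤ (‖L‖ * K1 + K3) * M := by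
      rw [i1]
      calc _ ≤ ‖L‖ * ‖F (X t) (V t) - F (X t) (A (V' t))‖
            + ‖F' (L (X t)) (V' t) - F' (X' t) (V' t)‖ :=
            (norm_add_le _ _).trans (add_le_add_left (L.le_opNorm _) _)
        _ ≤ ‖L‖ * (K1 * M) + K3 * M := by
            gcongr
            · exact e1.trans (by gcongr)
            · exact e3.trans (by gcongr)
        _ = _ := by ring
    have j2 : ‖G (X t) (V t) - A (G' (X' t) (V' t))‖ ≤ (K2 + ‖A‖ * K4) * M := by
      rw [i2]
      calc _ ≤ ‖G (X t) (V t) - G (X t) (A (V' t))‖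
            + ‖A‖ * ‖G' (L (X t)) (V' t) - G' (X' t) (V' t)‖ :=
            (norm_add_le _ _).trans (add_le_add_right (A.le_opNorm _) _)
        _ ≤ K2 * M + ‖A‖ * (K4 * M) := by
            gcongr
            · exact e2.trans (by gcongr)
            · exact e4.trans (by gcongr)
        _ = _ := by ring
    have n1 : 0 ≤ (‖L‖ * K1 + K3) * M := by positivity
    have n2 : 0 ≤ (K2 + ‖A‖ * K4) * M := by positivity
    rw [add_zero, add_mul]
    exact max_le (by linarith) (by linarith)
end

section
/- Let F, G : ℝ^N × ℝ^N → ℝ^N and let U₀ : ℝ^N → ℝ^N be monotone, and assume the map ℝ^{2N} ∋ (x,U) ↦ (G(x,U), F(x,U)) is monotone. Suppose (X₁, V₁) and (X₂, V₂) are continuously differentiable solutions on [0,T] of Ẋ = F(X,V), V̇ = G(X,V) with V_i(0) = U₀(X_i(0)) for i = 1,2. Then the function t ↦ ⟨X₁(t) − X₂(t), V₁(t) − V₂(t)⟩ is nondecreasing on [0,T] and nonnegative; in particular ⟨X₁(t) − X₂(t), V₁(t) − V₂(t)⟩ ≥ ⟨X₁(0) − X₂(0), U₀(X₁(0)) − U₀(X₂(0))⟩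 ≥ 0 for all t ∈ [0,T]. -/
open RealInnerProductSpace

/-- Along two solutions of the characteristic system `Ẋ = F(X,V)`, `V̇ = G(X,V)` with
monotone initial coupling `V(0) = U₀(X(0))`, the quantity `⟨X₁ − X₂, V₁ − V₂⟩` is
nondecreasing and nonnegative on `[0,T]`. -/
theorem characteristics_monotone_quantity (N : ℕ) (T : ℝ) (hT : 0 < T)
    (F G : EuclideanSpace ℝ (Fin N) → EuclideanSpace ℝ (Fin N) → EuclideanSpace ℝ (Fin N))
    (U₀ : EuclideanSpace ℝ (Fin N) → EuclideanSpace ℝ (Fin N))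
    (hU₀ : ∀ x y : EuclideanSpace ℝ (Fin N), 0 ≤ ⟪U₀ x - U₀ y, x - y⟫)
    (hmono : ∀ x y U W : EuclideanSpace ℝ (Fin N),
      0 ≤ ⟪G x U - G y W, x - y⟫ + ⟪F x U - F y W, U - W⟫)
    (X₁ V₁ X₂ V₂ : ℝ → EuclideanSpace ℝ (Fin N))
    (hX₁ : ∀ t ∈ Set.Icc (0 : ℝ) T, HasDerivAt X₁ (F (X₁ t) (V₁ t)) t)
    (hV₁ : ∀ t ∈ Set.Icc (0 : ℝ) T, HasDerivAt V₁ (G (X₁ t) (V₁ t)) t)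
    (hX₂ : ∀ t ∈ Set.Icc (0 : ℝ) T, HasDerivAt X₂ (F (X₂ t) (V₂ t)) t)
    (hV₂ : ∀ t ∈ Set.Icc (0 : ℝ) T, HasDerivAt V₂ (G (X₂ t) (V₂ t)) t)
    (hV₁0 : V₁ 0 = U₀ (X₁ 0))
    (hV₂0 : V₂ 0 = U₀ (X₂ 0)) :
    MonotoneOn (fun t => ⟪X₁ t - X₂ t, V₁ t - V₂ t⟫) (Set.Icc (0 : ℝ) T) ∧
    (∀ t ∈ Set.Icc (0 : ℝ) T, 0 ≤ ⟪X₁ t - X₂ t, V₁ t - V₂ t⟫) ∧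
    (∀ t ∈ Set.Icc (0 : ℝ) T,
      ⟪X₁ 0 - X₂ 0, U₀ (X₁ 0) - U₀ (X₂ 0)⟫ ≤ ⟪X₁ t - X₂ t, V₁ t - V₂ t⟫) ∧
    0 ≤ ⟪X₁ 0 - X₂ 0, U₀ (X₁ 0) - U₀ (X₂ 0)⟫ := by
  have hder : ∀ t ∈ Set.Icc (0 : ℝ) T, HasDerivAt (fun t => ⟪X₁ t - X₂ t, V₁ t - V₂ t⟫)
      (⟪X₁ t - X₂ t, G (X₁ t) (V₁ t) - G (X₂ t) (V₂ t)⟫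
        + ⟪F (X₁ t) (V₁ t) - F (X₂ t) (V₂ t), V₁ t - V₂ t⟫) t := fun t ht =>
    ((hX₁ t ht).sub (hX₂ t ht)).inner ℝ ((hV₁ t ht).sub (hV₂ t ht))
  have hm : MonotoneOn (fun t => ⟪X₁ t - X₂ t, V₁ t - V₂ t⟫) (Set.Icc (0 : ℝ) T) := by
    apply monotoneOn_of_deriv_nonneg (convex_Icc 0 T)
    · exact fun t ht => (hder t ht).continuousAt.continuousWithinAt
    · exact fun t ht =>
        (hder t (interior_subset ht)).differentiableAt.differentiableWithinAt
    · intro t ht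
      rw [(hder t (interior_subset ht)).deriv, real_inner_comm]
      exact hmono _ _ _ _
  have h0 : 0 ≤ ⟪X₁ 0 - X₂ 0, U₀ (X₁ 0) - U₀ (X₂ 0)⟫ := by
    rw [real_inner_comm]
    exact hU₀ _ _
  have h1 : ∀ t ∈ Set.Icc (0 : ℝ) T,
      ⟪X₁ 0 - X₂ 0, U₀ (X₁ 0) - U₀ (X₂ 0)⟫ ≤ ⟪X₁ t - X₂ t, V₁ t - V₂ t⟫ := by
    intro t ht
    rw [← hV₁0, ← hV₂0]
    exact hm (Set.left_mem_Icc.2 hT.le) ht ht.1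
  exact ⟨hm, fun t ht => h0.trans (h1 t ht), h1, h0⟩
end

section
/- Let F, G : ℝ^N × ℝ^N → ℝ^N be locally Lipschitz, let U₀ : ℝ^N → ℝ^N be monotone, and assume the map ℝ^{2N} ∋ (x,U) ↦ (G(x,U), F(x,U)) is strictly monotone, i.e. ⟨G(x,U) − G(y,W), x − y⟩ + ⟨F(x,U) − F(y,W), U − W⟩ > 0 whenever (x,U) ≠ (y,W). Suppose (X₁, V₁) and (X₂, V₂) are continuously differentiable solutions on [0,T] of Ẋ = F(X,V), V̇ = G(X,V) with V_i(0) = U₀(X_i(0)) for i = 1,2, and X₁(0) ≠ X₂(0). Then X₁(t) ≠ X₂(t) for every t ∈ [0,T]; that is, for each t, the characteristic flow map x ↦ X(t;x) is injective. -/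
open RealInnerProductSpace

/-- If `(x,U) ↦ (G(x,U), F(x,U))` is strictly monotone and `U₀` is monotone, then two
characteristics starting from distinct points never collide: the characteristic flow is
injective. -/
theorem characteristics_injective_flow (N : ℕ) (T : ℝ) (hT : 0 < T)
    (F G : EuclideanSpace ℝ (Fin N) → EuclideanSpace ℝ (Fin N) → EuclideanSpace ℝ (Fin N))
    (hFlip : LocallyLipschitz fun p : EuclideanSpace ℝ (Fin N) × EuclideanSpace ℝ (Fin N) =>
      F p.1 p.2)
    (hGlip : LocallyLipschitz fun p : EuclideanSpace ℝ (Fin N) × EuclideanSpace ℝ (Fin N) =>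
      G p.1 p.2)
    (U₀ : EuclideanSpace ℝ (Fin N) → EuclideanSpace ℝ (Fin N))
    (hU₀ : ∀ x y : EuclideanSpace ℝ (Fin N), 0 ≤ ⟪U₀ x - U₀ y, x - y⟫)
    (hmono : ∀ x y U W : EuclideanSpace ℝ (Fin N), (x, U) ≠ (y, W) →
      0 < ⟪G x U - G y W, x - y⟫ + ⟪F x U - F y W, U - W⟫)
    (X₁ V₁ X₂ V₂ : ℝ → EuclideanSpace ℝ (Fin N))
    (hX₁ : ∀ t ∈ Set.Icc (0 : ℝ) T, HasDerivAt X₁ (F (X₁ t) (V₁ t)) t)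
    (hV₁ : ∀ t ∈ Set.Icc (0 : ℝ) T, HasDerivAt V₁ (G (X₁ t) (V₁ t)) t)
    (hX₂ : ∀ t ∈ Set.Icc (0 : ℝ) T, HasDerivAt X₂ (F (X₂ t) (V₂ t)) t)
    (hV₂ : ∀ t ∈ Set.Icc (0 : ℝ) T, HasDerivAt V₂ (G (X₂ t) (V₂ t)) t)
    (hV₁0 : V₁ 0 = U₀ (X₁ 0))
    (hV₂0 : V₂ 0 = U₀ (X₂ 0))
    (hne : X₁ 0 ≠ X₂ 0) :
    ∀ t ∈ Set.Icc (0 : ℝ) T, X₁ t ≠ X₂ t := by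
  intro t ht hX
  have hd : ∀ s ∈ Set.Icc (0 : ℝ) T, HasDerivAt (fun s => ⟪V₁ s - V₂ s, X₁ s - X₂ s⟫)
      (⟪G (X₁ s) (V₁ s) - G (X₂ s) (V₂ s), X₁ s - X₂ s⟫
        + ⟪F (X₁ s) (V₁ s) - F (X₂ s) (V₂ s), V₁ s - V₂ s⟫) s := by
    intro s hs
    have h := ((hV₁ s hs).sub (hV₂ s hs)).inner ℝ ((hX₁ s hs).sub (hX₂ s hs))
    refine h.congr_deriv ?_
    rw [add_comm, real_inner_comm (V₁ s - V₂ s)]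
    rfl
  have hnn : ∀ s, 0 ≤ ⟪G (X₁ s) (V₁ s) - G (X₂ s) (V₂ s), X₁ s - X₂ s⟫
        + ⟪F (X₁ s) (V₁ s) - F (X₂ s) (V₂ s), V₁ s - V₂ s⟫ := by
    intro s
    by_cases h : (X₁ s, V₁ s) = (X₂ s, V₂ s)
    · obtain ⟨h1, h2⟩ := Prod.mk.inj h
      simp [h1, h2]
    · exact (hmono _ _ _ _ h).le
  have hpos := hmono (X₁ 0) (X₂ 0) (V₁ 0) (V₂ 0) (fun h => hne (Prod.mk.inj h).1)
  have ht0 : 0 < t := lt_of_le_of_ne ht.1 (fun h => hne (by rw [h]; exact hX))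
  have hmon : MonotoneOn (fun s => ⟪V₁ s - V₂ s, X₁ s - X₂ s⟫) (Set.Icc 0 T) := by
    apply monotoneOn_of_deriv_nonneg (convex_Icc 0 T)
    · exact fun s hs => (hd s hs).continuousAt.continuousWithinAt
    · exact fun s hs => (hd s (interior_subset hs)).differentiableAt.differentiableWithinAt
    · intro s hs
      rw [(hd s (interior_subset hs)).deriv]
      exact hnn s
  have h0 : (0 : ℝ) ∈ Set.Icc 0 T := ⟨le_rfl, hT.le⟩
  have hφ0 : 0 ≤ ⟪V₁ 0 - V₂ 0, X₁ 0 - X₂ 0⟫ := by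
    rw [hV₁0, hV₂0]; exact hU₀ _ _
  have hφt : ⟪V₁ t - V₂ t, X₁ t - X₂ t⟫ = 0 := by simp [hX]
  have hzero : ∀ s ∈ Set.Icc 0 t, ⟪V₁ s - V₂ s, X₁ s - X₂ s⟫ = 0 := by
    intro s hs
    have hsT : s ∈ Set.Icc 0 T := ⟨hs.1, hs.2.trans ht.2⟩
    have h1 := hmon h0 hsT hs.1
    have h2 := hmon hsT ht hs.2
    simp only at h1 h2
    linarith
  have hA := (hd 0 h0).hasDerivWithinAt (s := Set.Icc 0 t)
  have hB : HasDerivWithinAt (fun s => ⟪V₁ s - V₂ s, X₁ s - X₂ s⟫) 0 (Set.Icc 0 t) 0 :=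
    (hasDerivWithinAt_const (0 : ℝ) (Set.Icc 0 t) (0 : ℝ)).congr hzero
      (hzero 0 ⟨le_rfl, ht0.le⟩)
  have := (uniqueDiffOn_Icc ht0 0 ⟨le_rfl, ht0.le⟩).eq_deriv _ hA hB
  linarith
end

section
/- Let h : ℝ^m × ℝ^m → ℝ^m be continuously differentiable in its second variable with Jacobian h_u, let g : ℝ^m → ℝ^m be strictly monotone, and assume the map (z,u) ↦ (−h(z,u), h_u(z,u)* z) is monotone on ℝ^m × ℝ^m. Fix T > 0 and z₁ ≠ z₂ in ℝ^m, and suppose (Z_i, U_i) : [0,T] → ℝ^m × ℝ^m for i = 1,2 are continuously differentiable solutions of the backward characteristic system Ż = −h_u(Z, U)* Z, U̇ = h(Z, U) with terminal conditions Z_i(T) = z_i, U_i(T) = g(z_i). Then for every t ∈ [0,T], ⟨Z₁(t) − Z₂(t), U₁(t) − U₂(t)⟩ ≥ ⟨z₁ − z₂, g(z₁) − g(z₂)⟩ > 0; in particular Z₁(t) ≠ Z₂(t) for all t ∈ [0,T]. -/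
open RealInnerProductSpace

/-- Monotonicity of the backward characteristic flow for the reduced master equation:
if `(z,u) ↦ (−h(z,u), h_u(z,u)* z)` is monotone and `g` is strictly monotone, then along
two solutions of `Ż = −h_u(Z,U)* Z`, `U̇ = h(Z,U)` with terminal data `Z_i(T) = z_i`,
`U_i(T) = g(z_i)`, one has `⟨Z₁ − Z₂, U₁ − U₂⟩ ≥ ⟨z₁ − z₂, g(z₁) − g(z₂)⟩ > 0`; in
particular `Z₁(t) ≠ Z₂(t)` for all `t`. -/
theorem reduced_characteristics_strictly_monotone (m : ℕ) (T : ℝ) (hT : 0 < T)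
    (h : EuclideanSpace ℝ (Fin m) → EuclideanSpace ℝ (Fin m) → EuclideanSpace ℝ (Fin m))
    (hdiff : ∀ z : EuclideanSpace ℝ (Fin m), Differentiable ℝ (h z))
    (hcont : Continuous fun p : EuclideanSpace ℝ (Fin m) × EuclideanSpace ℝ (Fin m) =>
      fderiv ℝ (h p.1) p.2)
    (g : EuclideanSpace ℝ (Fin m) → EuclideanSpace ℝ (Fin m))
    (hg : ∀ z w : EuclideanSpace ℝ (Fin m), z ≠ w → 0 < ⟪g z - g w, z - w⟫)
    (hmono : ∀ z₁ u₁ z₂ u₂ : EuclideanSpace ℝ (Fin m),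
      0 ≤ ⟪-h z₁ u₁ - -h z₂ u₂, z₁ - z₂⟫ +
        ⟪(ContinuousLinearMap.adjoint (fderiv ℝ (h z₁) u₁)) z₁ -
            (ContinuousLinearMap.adjoint (fderiv ℝ (h z₂) u₂)) z₂, u₁ - u₂⟫)
    (z₁ z₂ : EuclideanSpace ℝ (Fin m)) (hz : z₁ ≠ z₂)
    (Z₁ U₁ Z₂ U₂ : ℝ → EuclideanSpace ℝ (Fin m))
    (hZ₁ : ∀ t ∈ Set.Icc (0 : ℝ) T, HasDerivAt Z₁
      (-(ContinuousLinearMap.adjoint (fderiv ℝ (h (Z₁ t)) (U₁ t))) (Z₁ t)) t)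
    (hU₁ : ∀ t ∈ Set.Icc (0 : ℝ) T, HasDerivAt U₁ (h (Z₁ t) (U₁ t)) t)
    (hZ₂ : ∀ t ∈ Set.Icc (0 : ℝ) T, HasDerivAt Z₂
      (-(ContinuousLinearMap.adjoint (fderiv ℝ (h (Z₂ t)) (U₂ t))) (Z₂ t)) t)
    (hU₂ : ∀ t ∈ Set.Icc (0 : ℝ) T, HasDerivAt U₂ (h (Z₂ t) (U₂ t)) t)
    (hZ₁T : Z₁ T = z₁) (hU₁T : U₁ T = g z₁)
    (hZ₂T : Z₂ T = z₂) (hU₂T : U₂ T = g z₂) :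
    ∀ t ∈ Set.Icc (0 : ℝ) T,
      ⟪z₁ - z₂, g z₁ - g z₂⟫ ≤ ⟪Z₁ t - Z₂ t, U₁ t - U₂ t⟫ ∧
      0 < ⟪z₁ - z₂, g z₁ - g z₂⟫ ∧
      Z₁ t ≠ Z₂ t := by
  have hd : ∀ t ∈ Set.Icc (0 : ℝ) T,
      HasDerivAt (fun s => ⟪Z₁ s - Z₂ s, U₁ s - U₂ s⟫)
        (⟪Z₁ t - Z₂ t, h (Z₁ t) (U₁ t) - h (Z₂ t) (U₂ t)⟫ +
          ⟪-(ContinuousLinearMap.adjoint (fderiv ℝ (h (Z₁ t)) (U₁ t))) (Z₁ t) -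
            -(ContinuousLinearMap.adjoint (fderiv ℝ (h (Z₂ t)) (U₂ t))) (Z₂ t),
            U₁ t - U₂ t⟫) t := fun t ht =>
    HasDerivAt.inner ℝ ((hZ₁ t ht).sub (hZ₂ t ht)) ((hU₁ t ht).sub (hU₂ t ht))
  have hanti : AntitoneOn (fun s => ⟪Z₁ s - Z₂ s, U₁ s - U₂ s⟫) (Set.Icc (0 : ℝ) T) := by
    apply antitoneOn_of_deriv_nonpos (convex_Icc 0 T)
    · exact fun t ht => (hd t ht).continuousAt.continuousWithinAt
    · exact fun t ht =>
        (hd t (interior_subset ht)).differentiableAt.differentiableWithinAt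
    · intro t ht
      rw [(hd t (interior_subset ht)).deriv]
      have hm := hmono (Z₁ t) (U₁ t) (Z₂ t) (U₂ t)
      rw [real_inner_comm]
      simp only [inner_sub_left, inner_neg_left] at hm ⊢
      linarith
  have hpos : 0 < ⟪z₁ - z₂, g z₁ - g z₂⟫ := by
    rw [real_inner_comm]
    exact hg z₁ z₂ hz
  intro t ht
  have hle : ⟪z₁ - z₂, g z₁ - g z₂⟫ ≤ ⟪Z₁ t - Z₂ t, U₁ t - U₂ t⟫ := by
    have := hanti ht (Set.right_mem_Icc.mpr hT.le) ht.2
    simpa only [hZ₁T, hZ₂T, hU₁T, hU₂T] using this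
  refine ⟨hle, hpos, fun heq => ?_⟩
  rw [heq, sub_self, inner_zero_left] at hle
  linarith
end

section
/- Let q ≥ 2 and let a : [0,∞) → [0,∞), b : [0,∞) → ℝ, c : [0,∞) → ℝ be continuously differentiable, and define h(z,u) = (1/q) a(z)|u|^q + b(z)u + c(z). Then the conditions [for all z ≥ 0 and u ∈ ℝ: ∂_z h(z,u) ≤ 0, ∂²_{uu} h(z,u) ≥ 0, and z (∂²_{uz} h(z,u))² ≤ −4 ∂_z h(z,u) ∂²_{uu} h(z,u)] together with a(z) > 0 for all z ≥ 0 hold if and only if: a > 0, a' ≤ 0, c' ≤ 0, the function z ↦ a(z) z^{4(q−1)/q} is nondecreasing on [0,∞), b is constant in case q > 2, and b'(z)² ≤ 2 a'(z) c'(z) for all z ≥ 0 in case q = 2. Here ∂_z h(z,u) = (1/q)a'(z)|u|^q + b'(z)u + c'(z), ∂²_{uu} h(z,u) = (q−1)a(z)|u|^{q−2}, and ∂²_{uz} h(z,u) = a'(z)|u|^{q−2}u + b'(z). -/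
lemma aux_lin {P C : ℝ} (h : ∀ s : ℝ, 0 < s → P * s ≤ C) : P ≤ 0 := by
  by_contra hP
  push Not at hP
  have h1 := h ((|C| + 1) / P) (by positivity)
  rw [mul_div_cancel₀ _ hP.ne'] at h1
  linarith [le_abs_self C]

lemma aux_quad {P Q R : ℝ} (h : ∀ u : ℝ, P * u ^ 2 + Q * u + R ≤ 0) : P ≤ 0 := by
  apply aux_lin (C := -R)
  intro s hs
  have h1 := h (Real.sqrt s)
  have h2 := h (-Real.sqrt s)
  have h3 := Real.sq_sqrt hs.le
  rw [neg_sq] at h2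
  rw [h3] at h1 h2
  linarith

lemma aux_deriv {a a' : ℝ → ℝ} {p : ℝ} (ha : ∀ z : ℝ, HasDerivAt a (a' z) z) {z : ℝ} (hz : 0 < z) :
    HasDerivAt (fun z => a z * z ^ p) (z ^ (p - 1) * (a' z * z + p * a z)) z := by
  have h := (ha z).mul (Real.hasDerivAt_rpow_const (p := p) (Or.inl hz.ne'))
  have e : z ^ (p - 1) * (a' z * z + p * a z) = a' z * z ^ p + a z * (p * z ^ (p - 1)) := by
    rw [Real.rpow_sub_one hz.ne']
    field_simp
  rw [e]
  exact h

lemma aux_mono {a a' : ℝ → ℝ} {p : ℝ} (hp : 0 < p) (ha : ∀ z : ℝ, HasDerivAt a (a' z) z) :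
    MonotoneOn (fun z => a z * z ^ p) (Set.Ici (0 : ℝ)) ↔ ∀ z, 0 < z → 0 ≤ a' z * z + p * a z := by
  constructor
  · intro h z hz
    have hd := aux_deriv (p := p) ha hz
    have h1 : 0 ≤ derivWithin (fun z => a z * z ^ p) (Set.Ici (0 : ℝ)) z := h.derivWithin_nonneg
    rw [derivWithin_of_mem_nhds (Ici_mem_nhds hz), hd.deriv] at h1
    exact nonneg_of_mul_nonneg_right h1 (Real.rpow_pos_of_pos hz _)
  · intro h
    apply monotoneOn_of_deriv_nonneg (convex_Ici 0)
    · have : Continuous a := continuous_iff_continuousAt.2 fun z => (ha z).continuousAt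
      exact (this.mul (Real.continuous_rpow_const hp.le)).continuousOn
    · intro z hz
      rw [interior_Ici] at hz
      exact (aux_deriv ha hz).differentiableAt.differentiableWithinAt
    · intro z hz
      rw [interior_Ici] at hz
      rw [(aux_deriv ha hz).deriv]
      exact mul_nonneg (Real.rpow_nonneg (le_of_lt hz) _) (h z hz)

lemma aux_zero {f : ℝ → ℝ} (hf : Continuous f) (h : ∀ z, 0 < z → f z = 0) :
    ∀ z, 0 ≤ z → f z = 0 := by
  have hcl : IsClosed {z | f z = 0} := isClosed_eq hf continuous_const
  have h2 : closure (Set.Ioi (0:ℝ)) ⊆ {z | f z = 0} := hcl.closure_subset_iff.2 fun z hz => h z hz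
  rw [closure_Ioi] at h2
  exact fun z hz => h2 hz

lemma aux_div {z A p B : ℝ} (hA : A ≤ 0) (hB : 0 < B) (hp : 0 < p) (h : z * A ^ 2 ≤ -(p * B * A)) :
    0 ≤ A * z + p * B := by
  rcases hA.lt_or_eq with h0 | h0
  · by_contra hn
    push Not at hn
    nlinarith
  · subst h0
    have := mul_pos hp hB
    linarith

/-- pointwise equivalence for exponent two -/
lemma aux_two {z A B C D : ℝ} (hD : 0 < D) (hz : 0 ≤ z) :
    (∀ u : ℝ, (1/2) * A * u ^ 2 + B * u + C ≤ 0 ∧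
      z * (A * u + B) ^ 2 ≤ -4 * ((1/2) * A * u ^ 2 + B * u + C) * D) ↔
    (A ≤ 0 ∧ C ≤ 0 ∧ 0 ≤ A * z + 2 * D ∧ B ^ 2 ≤ 2 * A * C) := by
  constructor
  · intro h
    have hA : A ≤ 0 := by
      have := aux_quad (fun u => (h u).1)
      linarith
    refine ⟨hA, by simpa using (h 0).1, ?_, ?_⟩
    · apply aux_div hA hD two_pos
      have := aux_quad (P := z * A ^ 2 + 2 * A * D) (Q := 2 * z * A * B + 4 * B * D)
        (R := z * B ^ 2 + 4 * C * D) (fun u => by nlinarith [(h u).2])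
      linarith
    · have := discrim_le_zero (a := -(1/2) * A) (b := -B) (c := -C)
        (fun u => by nlinarith [(h u).1])
      unfold discrim at this
      nlinarith
  · rintro ⟨hA, hC, hm, hB⟩ u
    rcases hA.lt_or_eq with h0 | h0
    · have h1 : (1/2) * A * u ^ 2 + B * u + C ≤ 0 := by
        by_contra hn
        push Not at hn
        nlinarith [sq_nonneg (A * u + B)]
      refine ⟨h1, ?_⟩
      by_contra hn
      push Not at hn
      have h2 := mul_pos_of_neg_of_neg h0 (sub_neg.2 hn)
      have h3 := mul_nonneg hm (sq_nonneg (A * u + B))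
      have h4 := mul_nonneg hD.le (sub_nonneg.2 hB)
      nlinarith
    · subst h0
      have hB0 : B = 0 := by nlinarith
      subst hB0
      have := mul_nonneg (neg_nonneg.2 hC) hD.le
      constructor <;> nlinarith

/-- pointwise equivalence for exponent above two, with vanishing linear term -/
lemma aux_gt {q z A C D : ℝ} (hq : 2 < q) (hD : 0 < D) (hz : 0 ≤ z) :
    (∀ u : ℝ, (1/q) * A * |u| ^ q + C ≤ 0 ∧
      z * (A * |u| ^ (q - 2) * u) ^ 2 ≤
        -4 * ((1/q) * A * |u| ^ q + C) * ((q - 1) * D * |u| ^ (q - 2))) ↔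
    (A ≤ 0 ∧ C ≤ 0 ∧ 0 ≤ A * z + (4 * (q - 1) / q) * D) := by
  have hq0 : 0 < q := by linarith
  have hp : 0 < 4 * (q - 1) / q := div_pos (by linarith) hq0
  have key : ∀ u : ℝ, z * (A * |u| ^ (q - 2) * u) ^ 2 = |u| ^ (q - 2) * (z * A ^ 2 * |u| ^ q) := by
    intro u
    rcases eq_or_ne u 0 with rfl | hu
    · simp [Real.zero_rpow (show q - 2 ≠ 0 by linarith)]
    · have : |u| ^ q = |u| ^ (q - 2) * u ^ 2 := by
        rw [← sq_abs u, ← Real.rpow_two, ← Real.rpow_add (abs_pos.2 hu)]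
        congr 1
        ring
      rw [this]
      ring
  constructor
  · intro h
    have hs : ∀ s : ℝ, 0 < s → ∃ u : ℝ, 0 < u ∧ |u| = u ∧ u ^ q = s := fun s hs =>
      ⟨s ^ (q⁻¹), Real.rpow_pos_of_pos hs _, abs_of_pos (Real.rpow_pos_of_pos hs _),
        Real.rpow_inv_rpow hs.le hq0.ne'⟩
    have hA : A ≤ 0 := by
      have h1 : (1 / q) * A ≤ 0 := by
        apply aux_lin (C := -C)
        intro s h0
        obtain ⟨u, hu, hu1, hu2⟩ := hs s h0
        have := (h u).1
        rw [hu1, hu2] at this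
        linarith
      by_contra hn
      push Not at hn
      have : 0 < (1 / q) * A := by positivity
      linarith
    refine ⟨hA, ?_, ?_⟩
    · have := (h 0).1
      simpa [Real.zero_rpow hq0.ne'] using this
    · apply aux_div hA hD hp
      have h1 : z * A ^ 2 + 4 * (q - 1) / q * D * A ≤ 0 := by
        apply aux_lin (C := -4 * C * (q - 1) * D)
        intro s h0
        obtain ⟨u, hu, hu1, hu2⟩ := hs s h0
        have h2 := (h u).2
        rw [key, hu1, hu2] at h2
        have h3 : z * A ^ 2 * s ≤ -4 * (1 / q * A * s + C) * ((q - 1) * D) := by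
          refine le_of_mul_le_mul_left ?_ (Real.rpow_pos_of_pos hu (q - 2))
          linarith
        have h4 : 4 * (q - 1) / q = 4 * (q - 1) * (1 / q) := by ring
        rw [h4]
        linarith
      linarith
  · rintro ⟨hA, hC, hm⟩ u
    have hs : 0 ≤ |u| ^ q := by positivity
    have hr : 0 ≤ |u| ^ (q - 2) := by positivity
    constructor
    · have : 0 ≤ (1 / q) * (-A) * |u| ^ q := by
        have := neg_nonneg.2 hA
        positivity
      linarith
    · rw [key]
      have h1 : z * A ^ 2 * |u| ^ q ≤ -4 * (1 / q * A * |u| ^ q + C) * ((q - 1) * D) := by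
        have h2 := mul_nonneg (mul_nonneg hm (neg_nonneg.2 hA)) hs
        have h3 := mul_nonneg (mul_nonneg (neg_nonneg.2 hC) (show 0 ≤ q - 1 by linarith)) hD.le
        have h4 : 4 * (q - 1) / q = 4 * (q - 1) * (1 / q) := by ring
        rw [h4] at h2
        linarith
      have := mul_le_mul_of_nonneg_left h1 hr
      linarith


/-- Characterization of monotonicity for the one-dimensional reduced Hamiltonian
`h(z,u) = (1/q) a(z)|u|^q + b(z)u + c(z)` with `q ≥ 2`: the conditions `∂_z h ≤ 0`,
`∂²_{uu} h ≥ 0`, `z (∂²_{uz} h)² ≤ −4 ∂_z h ∂²_{uu} h` (together with `a > 0`) hold for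
all `z ≥ 0`, `u ∈ ℝ` if and only if `a > 0`, `a' ≤ 0`, `c' ≤ 0`,
`z ↦ a(z) z^{4(q−1)/q}` is nondecreasing on `[0,∞)`, `b` is constant when `q > 2`, and
`b'² ≤ 2 a' c'` when `q = 2`. -/
theorem abc_monotonicity_characterization (q : ℝ) (hq : 2 ≤ q)
    (a b c a' b' c' : ℝ → ℝ)
    (ha : ∀ z : ℝ, HasDerivAt a (a' z) z)
    (hb : ∀ z : ℝ, HasDerivAt b (b' z) z)
    (hc : ∀ z : ℝ, HasDerivAt c (c' z) z)
    (ha'c : Continuous a') (hb'c : Continuous b') (hc'c : Continuous c')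
    (hapos : ∀ z : ℝ, 0 ≤ z → 0 ≤ a z) :
    ((∀ z : ℝ, 0 ≤ z → ∀ u : ℝ,
        (1/q) * a' z * |u| ^ q + b' z * u + c' z ≤ 0 ∧
        0 ≤ (q - 1) * a z * |u| ^ (q - 2) ∧
        z * (a' z * |u| ^ (q - 2) * u + b' z) ^ 2 ≤
          -4 * ((1/q) * a' z * |u| ^ q + b' z * u + c' z) *
            ((q - 1) * a z * |u| ^ (q - 2))) ∧
      (∀ z : ℝ, 0 ≤ z → 0 < a z)) ↔
    ((∀ z : ℝ, 0 ≤ z → 0 < a z) ∧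
      (∀ z : ℝ, 0 ≤ z → a' z ≤ 0) ∧
      (∀ z : ℝ, 0 ≤ z → c' z ≤ 0) ∧
      MonotoneOn (fun z => a z * z ^ (4 * (q - 1) / q)) (Set.Ici (0 : ℝ)) ∧
      (2 < q → ∀ z₁ z₂ : ℝ, 0 ≤ z₁ → 0 ≤ z₂ → b z₁ = b z₂) ∧
      (q = 2 → ∀ z : ℝ, 0 ≤ z → (b' z) ^ 2 ≤ 2 * a' z * c' z)) := by

  have hq0 : 0 < q := by linarith
  have hp : 0 < 4 * (q - 1) / q := div_pos (by linarith) hq0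
  rw [aux_mono hp ha]
  rcases hq.eq_or_lt with h2 | h2
  · subst h2
    have hred : (4 * ((2:ℝ) - 1) / 2) = 2 := by norm_num
    rw [hred]
    have hu : ∀ u : ℝ, |u| ^ (2:ℝ) = u ^ 2 := fun u => by rw [Real.rpow_two, sq_abs]
    have hu' : ∀ u : ℝ, |u| ^ ((2:ℝ) - 2) = 1 := fun u => by rw [sub_self, Real.rpow_zero]
    simp only [hu, hu', mul_one]
    constructor
    · rintro ⟨h, hpos⟩
      have H := fun z (hz : 0 ≤ z) => (aux_two (hpos z hz) hz).1 fun u =>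
        ⟨(h z hz u).1, by linarith [(h z hz u).2.2]⟩
      exact ⟨hpos, fun z hz => (H z hz).1, fun z hz => (H z hz).2.1,
        fun z hz => (H z hz.le).2.2.1, fun hlt => absurd hlt (lt_irrefl _),
        fun _ z hz => (H z hz).2.2.2⟩
    · rintro ⟨hpos, hA, hC, hm, -, hB⟩
      refine ⟨fun z hz u => ?_, hpos⟩
      have hm' : 0 ≤ a' z * z + 2 * a z := by
        rcases hz.eq_or_lt with h0 | h0
        · subst h0
          have := hpos 0 le_rfl
          linarith
        · exact hm z h0
      have H := (aux_two (hpos z hz) hz).2 ⟨hA z hz, hC z hz, hm', hB trivial z hz⟩ u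
      have := hpos z hz
      exact ⟨H.1, by linarith, by linarith [H.2]⟩
  · have hne : q ≠ 2 := h2.ne'
    constructor
    · rintro ⟨h, hpos⟩
      have hb0 : ∀ z, 0 ≤ z → b' z = 0 := by
        apply aux_zero hb'c
        intro z hz
        have h1 := (h z hz.le 0).2.2
        simp only [abs_zero, Real.zero_rpow (show q - 2 ≠ 0 by linarith), mul_zero, zero_add] at h1
        by_contra hn
        have : 0 < z * b' z ^ 2 := by positivity
        linarith
      have H := fun z (hz : 0 ≤ z) => (aux_gt h2 (hpos z hz) hz).1 fun u => by
        have h1 := h z hz u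
        simp only [hb0 z hz, zero_mul, add_zero] at h1
        exact ⟨h1.1, h1.2.2⟩
      refine ⟨hpos, fun z hz => (H z hz).1, fun z hz => (H z hz).2.1,
        fun z hz => (H z hz.le).2.2, fun _ z₁ z₂ hz₁ hz₂ => ?_, fun he => absurd he hne⟩
      refine (convex_Ici (0:ℝ)).is_const_of_fderivWithin_eq_zero (𝕜 := ℝ) (f := b)
        (fun z _ => (hb z).differentiableAt.differentiableWithinAt) (fun z hz => ?_) hz₁ hz₂
      have := (hb z).hasDerivWithinAt (s := Set.Ici (0:ℝ))
      rw [hb0 z hz] at this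
      rw [this.hasFDerivWithinAt.fderivWithin (uniqueDiffOn_Ici 0 z hz)]
      ext
      simp
    · rintro ⟨hpos, hA, hC, hm, hB, -⟩
      have hb0 : ∀ z, 0 ≤ z → b' z = 0 := by
        apply aux_zero hb'c
        intro z hz
        have h1 : HasDerivAt b 0 z := by
          refine (hasDerivAt_const z (b 0)).congr_of_eventuallyEq ?_
          filter_upwards [Ici_mem_nhds hz] with y hy
          exact hB h2 y 0 hy le_rfl
        exact (hb z).unique h1
      refine ⟨fun z hz u => ?_, hpos⟩
      have hm' : 0 ≤ a' z * z + 4 * (q - 1) / q * a z := by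
        rcases hz.eq_or_lt with h0 | h0
        · subst h0
          have := mul_pos hp (hpos 0 le_rfl)
          linarith
        · exact hm z h0
      have H := (aux_gt h2 (hpos z hz) hz).2 ⟨hA z hz, hC z hz, hm'⟩ u
      simp only [hb0 z hz, zero_mul, add_zero]
      refine ⟨H.1, ?_, H.2⟩
      have := hpos z hz
      have : 0 ≤ q - 1 := by linarith
      positivity
end

section
/- Let f = (f₀, f₁, f₂) : ℝ³ → ℝ³ be monotone, and for Z = (Z₀, Z₁, Z₂) ∈ ℝ³ and u = (u₀, u₁, u₂) ∈ ℝ³ define h(Z, u) = ((1/2)u₁² − f₀(Z), u₁u₂ − f₁(Z), u₂² − f₂(Z)) and h_u(Z,u)*Z = (0, Z₀ u₁ + Z₁ u₂, Z₁ u₁ + 2 Z₂ u₂). Let 𝒞 = {(1, z₁, z₂) ∈ ℝ³ : z₁²/2 ≤ z₂}. Then for all Z, Z̃ ∈ 𝒞 and all u, ũ ∈ ℝ³: ⟨−(h(Z,u) − h(Z̃,ũ)), Z − Z̃⟩ + ⟨h_u(Z,u)*Z − h_u(Z̃,ũ)*Z̃, u − ũ⟩ ≥ 0. -/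
/-- The quadratic example: if `f = (f₀,f₁,f₂) : ℝ³ → ℝ³` is monotone, then the reduced
Hamiltonian `h(Z,u) = (u₁²/2 − f₀(Z), u₁u₂ − f₁(Z), u₂² − f₂(Z))` satisfies
`⟨−(h(Z,u) − h(Z̃,ũ)), Z − Z̃⟩ + ⟨h_u(Z,u)*Z − h_u(Z̃,ũ)*Z̃, u − ũ⟩ ≥ 0` on the moment
set `𝒞 = {(1,z₁,z₂) : z₁²/2 ≤ z₂}`, where `h_u(Z,u)*Z = (0, Z₀u₁+Z₁u₂, Z₁u₁+2Z₂u₂)`. -/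
theorem quadratic_example_monotone
    (f₀ f₁ f₂ : ℝ × ℝ × ℝ → ℝ)
    (hf : ∀ P Q : ℝ × ℝ × ℝ,
      0 ≤ (f₀ P - f₀ Q) * (P.1 - Q.1) + (f₁ P - f₁ Q) * (P.2.1 - Q.2.1) +
        (f₂ P - f₂ Q) * (P.2.2 - Q.2.2)) :
    ∀ z₁ z₂ w₁ w₂ : ℝ, z₁ ^ 2 / 2 ≤ z₂ → w₁ ^ 2 / 2 ≤ w₂ →
    ∀ u₀ u₁ u₂ v₀ v₁ v₂ : ℝ,
      0 ≤ -(((1:ℝ)/2) * u₁ ^ 2 - f₀ (1, z₁, z₂) - (((1:ℝ)/2) * v₁ ^ 2 - f₀ (1, w₁, w₂)))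
            * ((1:ℝ) - 1)
        + -((u₁ * u₂ - f₁ (1, z₁, z₂)) - (v₁ * v₂ - f₁ (1, w₁, w₂))) * (z₁ - w₁)
        + -((u₂ ^ 2 - f₂ (1, z₁, z₂)) - (v₂ ^ 2 - f₂ (1, w₁, w₂))) * (z₂ - w₂)
        + ((0:ℝ) - 0) * (u₀ - v₀)
        + ((1 * u₁ + z₁ * u₂) - (1 * v₁ + w₁ * v₂)) * (u₁ - v₁)
        + ((z₁ * u₁ + 2 * z₂ * u₂) - (w₁ * v₁ + 2 * w₂ * v₂)) * (u₂ - v₂) := by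
  intro z₁ z₂ w₁ w₂ hz hw u₀ u₁ u₂ v₀ v₁ v₂
  have h := hf (1, z₁, z₂) (1, w₁, w₂)
  simp only at h
  have h1 := mul_nonneg (sub_nonneg.mpr hz) (sq_nonneg (u₂ - v₂))
  have h2 := mul_nonneg (sub_nonneg.mpr hw) (sq_nonneg (u₂ - v₂))
  have h3 := sq_nonneg ((u₁ - v₁) + z₁ * (u₂ - v₂))
  have h4 := sq_nonneg ((u₁ - v₁) + w₁ * (u₂ - v₂))
  linarith
end

section
/- Let p > 1, 0 < c₀ < C₀, and let a : (0,∞) → ℝ be differentiable with δ₀ < φ^{1/p} a'(φ) ≤ δ₁ for all φ > 0, for some 0 < δ₀ < δ₁. For ψ, z > 0 define A(ψ,z) = (1/p)ψ^p − a(zψ^p)ψ and B(ψ,z) = ψ^{p−1} − a(zψ^p), and the symmetric 2×2 matrix M(ψ,z) with entries M₁₁ = −z ∂_ψ B(ψ,z), M₂₂ = ∂_z A(ψ,z), and M₁₂ = M₂₁ = (1/2)(∂_ψ A(ψ,z) − B(ψ,z) − z ∂_z B(ψ,z)). If δ₁ < (p−1) / ( (p + (p−1)²/4) C₀^{1 −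 1/p} ), then for all ψ, z with c₀ ≤ ψ ≤ C₀ and c₀ ≤ z ≤ C₀, one has trace M(ψ,z) < 0 and det M(ψ,z) > 0; in particular M(ψ,z) is negative definite. Explicitly, ∂_z A(ψ,z) = −a'(zψ^p)ψ^{p+1} ≤ −δ₀ c₀^p / C₀^{1/p} < 0 and z ∂_ψ B(ψ,z) = zψ^{p−2}( p−1 − p z ψ a'(zψ^p) ) > 0. -/
theorem quad_neg_aux (m n k v w : ℝ) (hm : m < 0) (hdet : 0 < m * k - n ^ 2)
    (h : ¬(v = 0 ∧ w = 0)) : m * v ^ 2 + 2 * n * v * w + k * w ^ 2 < 0 := by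
  have key : m * (m * v ^ 2 + 2 * n * v * w + k * w ^ 2)
      = (m * v + n * w) ^ 2 + (m * k - n ^ 2) * w ^ 2 := by ring
  have hpos : 0 < (m * v + n * w) ^ 2 + (m * k - n ^ 2) * w ^ 2 := by
    by_cases hw : w = 0
    · have hv : v ≠ 0 := fun hv => h ⟨hv, hw⟩
      subst hw
      have : m * v ≠ 0 := mul_ne_zero hm.ne hv
      have : 0 < (m * v) ^ 2 := by positivity
      simpa using this
    · have : 0 < (m * k - n ^ 2) * w ^ 2 := by positivity
      have := sq_nonneg (m * v + n * w)
      linarith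
  rw [← key] at hpos
  by_contra hc
  nlinarith [mul_nonneg (neg_nonneg.mpr hm.le) (not_lt.mp hc)]

/-- Negative definiteness of the symmetrized coefficient matrix `M(ψ,z)` in the
uniqueness proof for the reduced forward–backward system: if
`δ₁ < (p−1)/((p + (p−1)²/4) C₀^{1−1/p})` then, for `ψ, z ∈ [c₀, C₀]`,
`trace M < 0` and `det M > 0`, so `M` is negative definite; explicitly
`∂_z A(ψ,z) = −a'(zψ^p) ψ^{p+1} ≤ −δ₀ c₀^p / C₀^{1/p} < 0` and
`z ∂_ψ B(ψ,z) = z ψ^{p−2}(p−1 − p z ψ a'(zψ^p)) > 0`. -/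
theorem coefficient_matrix_negative_definite (p c₀ C₀ δ₀ δ₁ : ℝ)
    (hp : 1 < p) (hc₀ : 0 < c₀) (hcC : c₀ < C₀) (hδ₀ : 0 < δ₀) (hδ : δ₀ < δ₁)
    (a : ℝ → ℝ)
    (ha : ∀ φ : ℝ, 0 < φ → DifferentiableAt ℝ a φ)
    (haδ : ∀ φ : ℝ, 0 < φ →
      δ₀ < φ ^ (1/p) * deriv a φ ∧ φ ^ (1/p) * deriv a φ ≤ δ₁)
    (A B : ℝ → ℝ → ℝ)
    (hA : A = fun ψ z => (1/p) * ψ ^ p - a (z * ψ ^ p) * ψ)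
    (hB : B = fun ψ z => ψ ^ (p - 1) - a (z * ψ ^ p))
    (hδ₁ : δ₁ < (p - 1) / ((p + (p - 1) ^ 2 / 4) * C₀ ^ (1 - 1/p))) :
    ∀ ψ z : ℝ, c₀ ≤ ψ → ψ ≤ C₀ → c₀ ≤ z → z ≤ C₀ →
      (-(z * deriv (fun ψ' => B ψ' z) ψ) + deriv (fun z' => A ψ z') z < 0) ∧
      (0 < -(z * deriv (fun ψ' => B ψ' z) ψ) * deriv (fun z' => A ψ z') z -
        ((1/2) * (deriv (fun ψ' => A ψ' z) ψ - B ψ z -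
          z * deriv (fun z' => B ψ z') z)) ^ 2) ∧
      (∀ v w : ℝ, ¬(v = 0 ∧ w = 0) →
        -(z * deriv (fun ψ' => B ψ' z) ψ) * v ^ 2 +
          2 * ((1/2) * (deriv (fun ψ' => A ψ' z) ψ - B ψ z -
            z * deriv (fun z' => B ψ z') z)) * v * w +
          deriv (fun z' => A ψ z') z * w ^ 2 < 0) ∧
      deriv (fun z' => A ψ z') z = -(deriv a (z * ψ ^ p)) * ψ ^ (p + 1) ∧
      deriv (fun z' => A ψ z') z ≤ -(δ₀ * c₀ ^ p / C₀ ^ (1/p)) ∧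
      deriv (fun z' => A ψ z') z < 0 ∧
      z * deriv (fun ψ' => B ψ' z) ψ =
        z * ψ ^ (p - 2) * (p - 1 - p * z * ψ * deriv a (z * ψ ^ p)) ∧
      0 < z * deriv (fun ψ' => B ψ' z) ψ := by
  intro ψ z h1 h2 h3 h4
  have hψ : 0 < ψ := by linarith
  have hz : 0 < z := by linarith
  have hC : 0 < C₀ := by linarith
  have hp0 : 0 < p := by linarith
  have hφ : 0 < z * ψ ^ p := by positivity
  obtain ⟨hd0, hd1⟩ := haδ _ hφ
  have had := (ha _ hφ).hasDerivAt
  set d := deriv a (z * ψ ^ p) with hd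
  have e1 : (z * ψ ^ p) ^ (1 / p) = z ^ (1 / p) * ψ := by
    rw [Real.mul_rpow hz.le (by positivity), ← Real.rpow_mul hψ.le,
      mul_one_div_cancel hp0.ne', Real.rpow_one]
  rw [e1] at hd0 hd1
  have x1 : ψ ^ (p - 1) = ψ ^ (p - 2) * ψ := by
    rw [← Real.rpow_add_one hψ.ne']; congr 1; ring
  have x0 : ψ ^ p = ψ ^ (p - 2) * ψ ^ 2 := by
    rw [pow_two, ← mul_assoc, ← x1, ← Real.rpow_add_one hψ.ne']; congr 1; ring
  have x2 : ψ ^ (p + 1) = ψ ^ (p - 2) * ψ ^ 3 := by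
    rw [Real.rpow_add_one hψ.ne', x0]; ring
  have hpow : HasDerivAt (fun t : ℝ => t ^ p) (p * ψ ^ (p - 1)) ψ :=
    Real.hasDerivAt_rpow_const (Or.inl hψ.ne')
  have hpow1 : HasDerivAt (fun t : ℝ => t ^ (p - 1)) ((p - 1) * ψ ^ (p - 1 - 1)) ψ :=
    Real.hasDerivAt_rpow_const (Or.inl hψ.ne')
  have haψ : HasDerivAt (fun t : ℝ => a (z * t ^ p)) (d * (z * (p * ψ ^ (p - 1)))) ψ :=
    HasDerivAt.comp (h₂ := a) (h := fun t : ℝ => z * t ^ p) ψ had (hpow.const_mul z)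
  have haz : HasDerivAt (fun t : ℝ => a (t * ψ ^ p)) (d * (1 * ψ ^ p)) z :=
    HasDerivAt.comp (h₂ := a) (h := fun t : ℝ => t * ψ ^ p) z had
      ((hasDerivAt_id z).mul_const (ψ ^ p))
  have dBψ : deriv (fun ψ' => B ψ' z) ψ
      = ψ ^ (p - 2) * (p - 1 - p * z * ψ * d) := by
    rw [hB]
    refine (hpow1.sub haψ).deriv.trans ?_
    rw [show p - 1 - 1 = p - 2 by ring, x1]; ring
  have dAz : deriv (fun z' => A ψ z') z = -d * ψ ^ (p + 1) := by
    rw [hA]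
    refine ((haz.mul_const ψ).const_sub (1 / p * ψ ^ p)).deriv.trans ?_
    rw [x2, x0]; ring
  have dBz : deriv (fun z' => B ψ z') z = -d * ψ ^ p := by
    rw [hB]
    refine (haz.const_sub (ψ ^ (p - 1))).deriv.trans ?_
    ring
  have dAψ : deriv (fun ψ' => A ψ' z) ψ - B ψ z = - p * z * d * ψ ^ p := by
    rw [hA, hB]
    have := ((hpow.const_mul (1 / p)).sub (haψ.mul (hasDerivAt_id ψ))).deriv
    have h' : deriv (fun ψ' => 1 / p * ψ' ^ p - a (z * ψ' ^ p) * ψ') ψ = _ := this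
    simp only [h', id]
    rw [x0, x1]; field_simp; ring
  have hzp : 0 < z ^ (1 / p) := by positivity
  have hdpos : 0 < d := by
    by_contra hc
    nlinarith [mul_nonneg (mul_pos hzp hψ).le (neg_nonneg.mpr (not_lt.mp hc))]
  have hK : 0 < p + (p - 1) ^ 2 / 4 := by positivity
  have hq : 0 ≤ 1 - 1 / p := by
    rw [sub_nonneg, div_le_one hp0]; exact hp.le
  have hzz : z = z ^ (1 - 1 / p) * z ^ (1 / p) := by
    rw [← Real.rpow_add hz]; simp
  have hmain : (p + (p - 1) ^ 2 / 4) * (z * ψ * d) < p - 1 := by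
    have a1 : z * ψ * d ≤ δ₁ * C₀ ^ (1 - 1 / p) := by
      calc z * ψ * d = (z ^ (1 / p) * ψ * d) * z ^ (1 - 1 / p) := by
            conv_lhs => rw [hzz]
            ring
        _ ≤ δ₁ * C₀ ^ (1 - 1 / p) := by
            have : z ^ (1 - 1 / p) ≤ C₀ ^ (1 - 1 / p) := Real.rpow_le_rpow hz.le h4 hq
            have h0 : 0 ≤ z ^ (1 - 1 / p) := by positivity
            exact mul_le_mul hd1 this h0 (by linarith)
    rw [lt_div_iff₀ (by positivity)] at hδ₁
    nlinarith [mul_le_mul_of_nonneg_left a1 hK.le]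
  have hs : 0 < z * ψ * d := by positivity
  have hfac : 0 < p - 1 - p * z * ψ * d := by nlinarith [mul_nonneg (sq_nonneg (p - 1)) hs.le]
  have hxp : 0 < ψ ^ (p - 2) := by positivity
  have hM11 : 0 < z * deriv (fun ψ' => B ψ' z) ψ := by rw [dBψ]; positivity
  have hM22 : deriv (fun z' => A ψ z') z < 0 := by
    rw [dAz]
    have : 0 < d * ψ ^ (p + 1) := by positivity
    linarith
  have hdet : 0 < -(z * deriv (fun ψ' => B ψ' z) ψ) * deriv (fun z' => A ψ z') z -
        ((1/2) * (deriv (fun ψ' => A ψ' z) ψ - B ψ z -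
          z * deriv (fun z' => B ψ z') z)) ^ 2 := by
    rw [dAψ, dBz, dAz, dBψ, x2, x0]
    have hf : 0 < p - 1 - (p + (p - 1) ^ 2 / 4) * (z * ψ * d) := by linarith
    have : 0 < z * d * (ψ ^ (p - 2)) ^ 2 * ψ ^ 3 *
      (p - 1 - (p + (p - 1) ^ 2 / 4) * (z * ψ * d)) := by positivity
    convert this using 1
    ring
  refine ⟨by linarith, hdet, ?_, dAz, ?_, hM22, ?_, hM11⟩
  · intro v w hvw
    exact quad_neg_aux _ _ _ v w (by linarith) hdet hvw
  · rw [dAz]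
    have b1 : c₀ ^ p ≤ ψ ^ p := Real.rpow_le_rpow hc₀.le h1 hp0.le
    have b2 : z ^ (1 / p) ≤ C₀ ^ (1 / p) := Real.rpow_le_rpow hz.le h4 (by positivity)
    have b3 : δ₀ * c₀ ^ p / C₀ ^ (1 / p) ≤ (z ^ (1 / p) * ψ * d) * ψ ^ p / z ^ (1 / p) := by
      gcongr
    have b4 : (z ^ (1 / p) * ψ * d) * ψ ^ p / z ^ (1 / p) = d * ψ ^ (p + 1) := by
      rw [Real.rpow_add_one hψ.ne']; field_simp
    linarith
  · rw [dBψ]; ring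
end

section
/- Let T > 0, L₀ > 0, K ≥ 0, and let U, V : [0,T] × ℝ^N → ℝ^N be maps such that U(t,·) is L₀-Lipschitz for every t ∈ [0,T], and ⟨U(t,x) − V(t,y), x − y⟩ ≥ −K for all t ∈ [0,T] and x, y ∈ ℝ^N. Then sup_{(t,y) ∈ [0,T] × ℝ^N} |U(t,y) − V(t,y)| ≤ 2 √(K L₀). -/
open RealInnerProductSpace

/-- Optimization step of the stability estimate: if `U(t,·)` is `L₀`-Lipschitz and
`⟨U(t,x) − V(t,y), x − y⟩ ≥ −K` for all `t ∈ [0,T]`, `x, y`, then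
`|U(t,y) − V(t,y)| ≤ 2√(K L₀)` everywhere. -/
theorem stability_optimization_step (N : ℕ) (T L₀ K : ℝ)
    (hT : 0 < T) (hL₀ : 0 < L₀) (hK : 0 ≤ K)
    (U V : ℝ → EuclideanSpace ℝ (Fin N) → EuclideanSpace ℝ (Fin N))
    (hLip : ∀ t ∈ Set.Icc (0 : ℝ) T, ∀ x y : EuclideanSpace ℝ (Fin N),
      ‖U t x - U t y‖ ≤ L₀ * ‖x - y‖)
    (hlow : ∀ t ∈ Set.Icc (0 : ℝ) T, ∀ x y : EuclideanSpace ℝ (Fin N),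
      -K ≤ ⟪U t x - V t y, x - y⟫) :
    ∀ t ∈ Set.Icc (0 : ℝ) T, ∀ y : EuclideanSpace ℝ (Fin N),
      ‖U t y - V t y‖ ≤ 2 * Real.sqrt (K * L₀) := by
  intro t ht y
  have h1 := hlow t ht (y - (1 / (2 * L₀)) • (U t y - V t y)) y
  have h2 := hLip t ht (y - (1 / (2 * L₀)) • (U t y - V t y)) y
  generalize hx : y - (1 / (2 * L₀)) • (U t y - V t y) = x at h1 h2
  have hxy : x - y = -((1 / (2 * L₀)) • (U t y - V t y)) := by
    rw [← hx]; abel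
  have hs : 0 < 1 / (2 * L₀) := by positivity
  have hn : ‖x - y‖ = 1 / (2 * L₀) * ‖U t y - V t y‖ := by
    rw [hxy, norm_neg, norm_smul, Real.norm_of_nonneg hs.le]
  have h3 : ⟪U t x - U t y, x - y⟫ ≤ L₀ * ‖x - y‖ * ‖x - y‖ :=
    (real_inner_le_norm _ _).trans (mul_le_mul_of_nonneg_right h2 (norm_nonneg _))
  have h4 : ⟪U t y - V t y, x - y⟫ = -(1 / (2 * L₀) * ‖U t y - V t y‖ ^ 2) := by
    rw [hxy, inner_neg_right, real_inner_smul_right, real_inner_self_eq_norm_sq]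
  have h5 : U t x - V t y = (U t x - U t y) + (U t y - V t y) := by abel
  rw [h5, inner_add_left, h4] at h1
  rw [hn] at h3
  generalize ‖U t y - V t y‖ = w at *
  have h6 : L₀ * (1 / (2 * L₀) * w) * (1 / (2 * L₀) * w) - 1 / (2 * L₀) * w ^ 2
      = -(w ^ 2 / (4 * L₀)) := by
    field_simp; ring
  have h7 : w ^ 2 / (4 * L₀) ≤ K := by linarith
  rw [div_le_iff₀ (by positivity)] at h7
  have h8 : w / 2 ≤ Real.sqrt (K * L₀) := by
    apply Real.le_sqrt_of_sq_le
    nlinarith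
  linarith
end
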